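/- Let p be a prime number and let T ⊂ [0, p−1] × [0, p−1] be a right triangle (the convex hull of three points forming a right triangle) whose two legs are parallel to the coordinate axes. Let 𝓘(T) denote the number of pairs of positive integers (x, y) lying in T with xy ≡ 1 (mod p). Then |𝓘(T) − Area(T)/p| < 3 · p^{3/4} · log p, where log denotes the natural logarithm. -/

import Mathlib

open MeasureTheory

/-- The number of points `(x, y)` with positive integer coordinates lying in the
set `S ⊆ ℝ²` and satisfying `x y ≡ 1 (mod p)`. -/
noncomputable def invCount (p : ℕ) (S : Set (ℝ × ℝ)) : ℕ :=
  ({xy : ℕ × ℕ | 0 < xy.1 ∧ 0 < xy.2 ∧ ((xy.1 : ℝ), (xy.2 : ℝ)) ∈ S ∧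
    xy.1 * xy.2 ≡ 1 [MOD p]}).ncard

open Finset in
/-- Parseval's identity on `(ℤ/pℤ)²`: the second moment of a family of exponential sums counts
coincidences. -/
lemma sum_sum_norm_sq_stdAddChar {p : ℕ} [NeZero p] {ι : Type*} [Fintype ι] (f g : ι → ZMod p) :
    ∑ a : ZMod p, ∑ b : ZMod p, ‖∑ i, ZMod.stdAddChar (a * f i + b * g i)‖ ^ 2 =
      (p : ℝ) ^ 2 * #{ij : ι × ι | f ij.1 = f ij.2 ∧ g ij.1 = g ij.2} := by
  have key : ∀ c : ZMod p, ∑ a : ZMod p, (ZMod.stdAddChar (a * c) : ℂ) =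
      if c = 0 then (p : ℂ) else 0 := by
    intro c
    rw [AddChar.sum_mulShift c (ZMod.isPrimitive_stdAddChar p), ZMod.card]
    split_ifs <;> simp
  have h1 : ∀ a b : ZMod p,
      (((‖∑ i, (ZMod.stdAddChar (a * f i + b * g i) : ℂ)‖ ^ 2 : ℝ)) : ℂ) =
      ∑ ij : ι × ι, ZMod.stdAddChar (a * (f ij.1 - f ij.2)) *
        ZMod.stdAddChar (b * (g ij.1 - g ij.2)) := by
    intro a b
    push_cast
    rw [← Complex.mul_conj', map_sum, sum_mul_sum, ← sum_product', univ_product_univ]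
    refine sum_congr rfl fun ij _ => ?_
    rw [← AddChar.map_neg_eq_conj, ← AddChar.map_add_eq_mul, ← AddChar.map_add_eq_mul]
    congr 1
    ring
  apply Complex.ofReal_injective
  push_cast
  have h2 : ∀ a b : ZMod p,
      ((‖∑ i, (ZMod.stdAddChar (a * f i + b * g i) : ℂ)‖ : ℂ)) ^ 2 =
      ∑ ij : ι × ι, ZMod.stdAddChar (a * (f ij.1 - f ij.2)) *
        ZMod.stdAddChar (b * (g ij.1 - g ij.2)) := by
    intro a b
    rw [← h1]; push_cast; rfl
  simp_rw [h2]
  have h3 : ∀ a : ZMod p, ∑ b : ZMod p, ∑ ij : ι × ι,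
      (ZMod.stdAddChar (a * (f ij.1 - f ij.2)) : ℂ) * ZMod.stdAddChar (b * (g ij.1 - g ij.2)) =
      ∑ ij : ι × ι, (ZMod.stdAddChar (a * (f ij.1 - f ij.2)) : ℂ) *
        (if g ij.1 - g ij.2 = 0 then (p : ℂ) else 0) := by
    intro a
    rw [sum_comm]
    refine sum_congr rfl fun ij _ => ?_
    rw [← mul_sum, key]
  simp_rw [h3]
  rw [sum_comm]
  simp_rw [← sum_mul, key, sub_eq_zero]
  rw [card_filter, Nat.cast_sum, mul_sum]
  refine sum_congr rfl fun ij _ => ?_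
  by_cases h : f ij.1 = f ij.2 <;> by_cases h' : g ij.1 = g ij.2 <;> simp [h, h', sq]

/-- The Kloosterman sum `∑ e_p(a u + b u⁻¹)` over the units `u` of `ℤ/pℤ`. -/
noncomputable def kloostermanSum (p : ℕ) [NeZero p] (a b : ZMod p) : ℂ :=
  ∑ u : (ZMod p)ˣ, ZMod.stdAddChar (a * (u : ZMod p) + b * ((u⁻¹ : (ZMod p)ˣ) : ZMod p))

open Finset in
lemma card_pairs_sum_inv_sum_le (F : Type*) [Field F] [Fintype F] [DecidableEq F] :
    #{q : (Fˣ × Fˣ) × (Fˣ × Fˣ) |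
      (q.1.1 : F) + q.1.2 = q.2.1 + q.2.2 ∧
      ((q.1.1⁻¹ : Fˣ) : F) + (q.1.2⁻¹ : Fˣ) = (q.2.1⁻¹ : Fˣ) + (q.2.2⁻¹ : Fˣ)} ≤
      3 * Fintype.card Fˣ ^ 2 := by
  let U : Finset (Fˣ × Fˣ) := univ
  have hU : #U = Fintype.card Fˣ ^ 2 := by simp [U, sq]
  have hsub : ({q : (Fˣ × Fˣ) × (Fˣ × Fˣ) |
      (q.1.1 : F) + q.1.2 = q.2.1 + q.2.2 ∧
      ((q.1.1⁻¹ : Fˣ) : F) + (q.1.2⁻¹ : Fˣ) = (q.2.1⁻¹ : Fˣ) + (q.2.2⁻¹ : Fˣ)} : Finset _) ⊆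
      (U.image (fun v => ((v.1, v.2), (v.1, v.2))) ∪ U.image (fun v => ((v.1, v.2), (v.2, v.1)))) ∪
        U.image (fun v => ((v.1, -v.1), (v.2, -v.2))) := by
    rintro ⟨⟨x, y⟩, ⟨z, w⟩⟩ h
    simp only [mem_filter, mem_univ, true_and, Units.val_inv_eq_inv_val] at h
    obtain ⟨h1, h2⟩ := h
    have hx := x.ne_zero
    have hy := y.ne_zero
    have hz := z.ne_zero
    have hw := w.ne_zero
    simp only [mem_union, mem_image, U, mem_univ, true_and, Prod.exists, Prod.mk.injEq]
    field_simp at h2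
    have h3 : ((x : F) + y) * ((x : F) * y - z * w) = 0 := by
      linear_combination ((x : F) * y) * h1 - h2
    rcases mul_eq_zero.1 h3 with h4 | h4
    · right
      refine ⟨x, z, ⟨rfl, ?_⟩, rfl, ?_⟩
      · ext; push_cast; linear_combination -h4
      · ext; push_cast; linear_combination -h4 + h1
    · left
      have h5 : ((x : F) - z) * (x - w) = 0 := by linear_combination (x : F) * h1 - h4
      rcases mul_eq_zero.1 h5 with h6 | h6
      · left
        refine ⟨x, y, ⟨rfl, rfl⟩, ?_, ?_⟩
        · ext; linear_combination h6
        · ext; linear_combination h1 - h6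
      · right
        refine ⟨x, y, ⟨rfl, rfl⟩, ?_, ?_⟩
        · ext; linear_combination h1 - h6
        · ext; linear_combination h6
  refine (card_le_card hsub).trans ?_
  refine (card_union_le _ _).trans ?_
  have h1 := card_union_le (U.image (fun v : Fˣ × Fˣ => ((v.1, v.2), (v.1, v.2))))
    (U.image (fun v => ((v.1, v.2), (v.2, v.1))))
  have h2 := card_image_le (s := U) (f := fun v : Fˣ × Fˣ => ((v.1, v.2), (v.1, v.2)))
  have h3 := card_image_le (s := U) (f := fun v : Fˣ × Fˣ => ((v.1, v.2), (v.2, v.1)))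
  have h4 := card_image_le (s := U) (f := fun v : Fˣ × Fˣ => ((v.1, -v.1), (v.2, -v.2)))
  omega

lemma kloostermanSum_eq_mul_one {p : ℕ} [Fact p.Prime] (a : ZMod p) {b : ZMod p} (hb : b ≠ 0) :
    kloostermanSum p a b = kloostermanSum p (a * b) 1 := by
  unfold kloostermanSum
  rw [← Equiv.sum_comp (Equiv.mulLeft (Units.mk0 b hb))]
  refine Finset.sum_congr rfl fun u _ => ?_
  congr 1
  simp only [Equiv.coe_mulLeft, Units.val_mul, mul_inv, Units.val_inv_eq_inv_val, Units.val_mk0]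
  field_simp

/-- Kloosterman's fourth moment bound. -/
lemma sum_norm_kloostermanSum_pow_four_le {p : ℕ} [Fact p.Prime] {b : ZMod p} (hb : b ≠ 0) :
    ∑ a : ZMod p, ‖kloostermanSum p a b‖ ^ 4 ≤ 3 * (p : ℝ) ^ 3 := by
  have hinv : ∀ c : ZMod p, c ≠ 0 → ∑ a : ZMod p, ‖kloostermanSum p a c‖ ^ 4 =
      ∑ a : ZMod p, ‖kloostermanSum p a 1‖ ^ 4 := by
    intro c hc
    simp_rw [kloostermanSum_eq_mul_one _ hc]
    exact Equiv.sum_comp (Equiv.mulRight₀ c hc) (fun a => ‖kloostermanSum p a 1‖ ^ 4)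
  rw [hinv b hb]
  set Q := ∑ a : ZMod p, ‖kloostermanSum p a 1‖ ^ 4 with hQ
  have hp1 : (1 : ℝ) < p := by exact_mod_cast (Fact.out : p.Prime).one_lt
  have htot : ∑ a : ZMod p, ∑ c : ZMod p, ‖kloostermanSum p a c‖ ^ 4 ≤
      (p : ℝ) ^ 2 * (3 * ((p : ℝ) - 1) ^ 2) := by
    have h1 : ∀ a c : ZMod p, ‖kloostermanSum p a c‖ ^ 4 =
        ‖∑ i : (ZMod p)ˣ × (ZMod p)ˣ, (ZMod.stdAddChar (a * ((i.1 : ZMod p) + (i.2 : ZMod p)) +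
          c * (((i.1⁻¹ : (ZMod p)ˣ) : ZMod p) + ((i.2⁻¹ : (ZMod p)ˣ) : ZMod p))) : ℂ)‖ ^ 2 := by
      intro a c
      rw [show 4 = 2 * 2 from rfl, pow_mul, ← norm_pow, sq (kloostermanSum p a c)]
      unfold kloostermanSum
      rw [Finset.sum_mul_sum, ← Finset.sum_product', Finset.univ_product_univ]
      congr 2
      refine Finset.sum_congr rfl fun i _ => ?_
      rw [← AddChar.map_add_eq_mul]
      congr 1
      ring
    simp_rw [h1]
    rw [sum_sum_norm_sq_stdAddChar (fun i : (ZMod p)ˣ × (ZMod p)ˣ => (i.1 : ZMod p) + (i.2 : ZMod p))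
      (fun i => ((i.1⁻¹ : (ZMod p)ˣ) : ZMod p) + ((i.2⁻¹ : (ZMod p)ˣ) : ZMod p))]
    gcongr
    have := card_pairs_sum_inv_sum_le (ZMod p)
    rw [ZMod.card_units p] at this
    have h2 : ((3 * (p - 1) ^ 2 : ℕ) : ℝ) = 3 * ((p : ℝ) - 1) ^ 2 := by
      push_cast [Nat.cast_sub (Fact.out : p.Prime).one_lt.le]; ring
    rw [← h2]
    exact_mod_cast this
  rw [Finset.sum_comm] at htot
  have h3 : ((p : ℝ) - 1) * Q ≤ ∑ c : ZMod p, ∑ a : ZMod p, ‖kloostermanSum p a c‖ ^ 4 := by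
    have : ∑ c ∈ Finset.univ.erase (0 : ZMod p), ∑ a : ZMod p, ‖kloostermanSum p a c‖ ^ 4 =
        ((p : ℝ) - 1) * Q := by
      rw [Finset.sum_congr rfl fun c hc => hinv c (Finset.ne_of_mem_erase hc)]
      rw [Finset.sum_const, Finset.card_erase_of_mem (Finset.mem_univ _), Finset.card_univ,
        ZMod.card, nsmul_eq_mul, Nat.cast_sub (Fact.out : p.Prime).one_lt.le, Nat.cast_one]
    rw [← this]
    exact Finset.sum_le_sum_of_subset_of_nonneg (Finset.erase_subset _ _)
      fun _ _ _ => Finset.sum_nonneg fun _ _ => by positivity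
  have h4 : ((p : ℝ) - 1) * Q ≤ ((p : ℝ) - 1) * (3 * (p : ℝ) ^ 2 * (p - 1)) := by
    calc _ ≤ _ := h3.trans htot
      _ = _ := by ring
  have h5 := le_of_mul_le_mul_left h4 (by linarith)
  nlinarith [sq_nonneg (p : ℝ)]

/-- The additive character `e(t) = exp(2πit)` of `ℝ`. -/
noncomputable def unitExp (t : ℝ) : ℂ := Complex.exp (Complex.I * ((2 * Real.pi * t : ℝ) : ℂ))

lemma norm_unitExp (t : ℝ) : ‖unitExp t‖ = 1 := Complex.norm_exp_I_mul_ofReal _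

lemma unitExp_add (s t : ℝ) : unitExp (s + t) = unitExp s * unitExp t := by
  unfold unitExp
  rw [← Complex.exp_add]
  congr 1
  push_cast
  ring

lemma unitExp_re (t : ℝ) : (unitExp t).re = Real.cos (2 * Real.pi * t) := by
  unfold unitExp
  rw [mul_comm, Complex.exp_ofReal_mul_I_re]

lemma norm_unitExp_sub_one (t : ℝ) : ‖unitExp t - 1‖ = 2 * |Real.sin (Real.pi * t)| := by
  unfold unitExp
  rw [Complex.norm_exp_I_mul_ofReal_sub_one, norm_mul, Real.norm_eq_abs, Real.norm_eq_abs,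
    abs_of_pos (two_pos : (0 : ℝ) < 2)]
  congr 3
  ring

lemma norm_unitExp_sub_one_le (t : ℝ) : ‖unitExp t - 1‖ ≤ 2 * Real.pi * |t| := by
  refine (Real.norm_exp_I_mul_ofReal_sub_one_le).trans_eq ?_
  rw [Real.norm_eq_abs, abs_mul, abs_of_pos Real.two_pi_pos]

lemma norm_unitExp_sub_one_le_two (t : ℝ) : ‖unitExp t - 1‖ ≤ 2 := by
  refine (norm_sub_le _ _).trans_eq ?_
  rw [norm_unitExp, norm_one]
  norm_num

lemma stdAddChar_intCast_eq_unitExp {p : ℕ} [NeZero p] (j : ℤ) :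
    (ZMod.stdAddChar (j : ZMod p) : ℂ) = unitExp (j / p) := by
  rw [ZMod.stdAddChar_coe]
  unfold unitExp
  congr 1
  push_cast
  ring

lemma norm_sum_unitExp_mul_abs_sin_le (β : ℝ) (m n : ℕ) :
    ‖∑ x ∈ Finset.Ico m n, unitExp (β * x)‖ * |Real.sin (Real.pi * β)| ≤ 1 := by
  rcases le_or_gt n m with h | h
  · simp [Finset.Ico_eq_empty_of_le h]
  have htel : (unitExp β - 1) * ∑ x ∈ Finset.Ico m n, unitExp (β * x) =
      unitExp (β * n) - unitExp (β * m) := by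
    induction n, h.le using Nat.le_induction with
    | base => simp
    | succ k hk ih =>
      rcases hk.eq_or_lt with rfl | hk
      · rw [Finset.sum_Ico_succ_top le_rfl]
        simp only [Finset.Ico_self, Finset.sum_empty, zero_add]
        rw [show β * ((m + 1 : ℕ) : ℝ) = β + β * m by push_cast; ring, unitExp_add]
        ring
      · rw [Finset.sum_Ico_succ_top hk.le, mul_add, ih hk,
          show β * ((k + 1 : ℕ) : ℝ) = β + β * k by push_cast; ring, unitExp_add]
        ring
  have h2 : 2 * |Real.sin (Real.pi * β)| * ‖∑ x ∈ Finset.Ico m n, unitExp (β * x)‖ ≤ 2 := by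
    rw [← norm_unitExp_sub_one, ← norm_mul, htel]
    refine (norm_sub_le _ _).trans_eq ?_
    rw [norm_unitExp, norm_unitExp]
    norm_num
  linarith

/-- The Dirichlet kernel at a frequency `d / p` with `d ∈ [j, j + 1]`. -/
lemma norm_sum_unitExp_le {p j m n : ℕ} (hj : j < p) (hmn : n ≤ m + p) {d : ℝ}
    (hd : (j : ℝ) ≤ d) (hd' : d ≤ j + 1) :
    ‖∑ x ∈ Finset.Ico m n, unitExp (-(d / p) * x)‖ ≤
      p * max (1 / ((j : ℝ) + 1)) (1 / ((p : ℝ) - j)) := by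
  have hp : (0 : ℝ) < p := by exact_mod_cast (Nat.zero_le j).trans_lt hj
  have htriv : ‖∑ x ∈ Finset.Ico m n, unitExp (-(d / p) * x)‖ ≤ p := by
    refine (norm_sum_le _ _).trans ?_
    simp only [norm_unitExp, Finset.sum_const, Nat.card_Ico, nsmul_eq_mul, mul_one]
    exact_mod_cast (by omega : n - m ≤ p)
  have hjp : (j : ℝ) + 1 ≤ p := by exact_mod_cast hj
  rcases Nat.eq_zero_or_pos j with rfl | hj0
  · refine htriv.trans ?_
    have : (1 : ℝ) ≤ max (1 / (((0 : ℕ) : ℝ) + 1)) (1 / ((p : ℝ) - (0 : ℕ))) :=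
      le_max_of_le_left (by norm_num)
    nlinarith
  rcases Nat.eq_or_lt_of_le (Nat.succ_le_of_lt hj) with hj1 | hj1
  · refine htriv.trans ?_
    have h1 : (p : ℝ) - j = 1 := by rw [← hj1]; push_cast; ring
    have : (1 : ℝ) ≤ max (1 / ((j : ℝ) + 1)) (1 / ((p : ℝ) - j)) :=
      le_max_of_le_right (by rw [h1]; norm_num)
    nlinarith
  have hj0' : (1 : ℝ) ≤ j := by exact_mod_cast hj0
  have hj1' : (j : ℝ) + 2 ≤ p := by exact_mod_cast hj1
  have hmain := norm_sum_unitExp_mul_abs_sin_le (-(d / p)) m n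
  set Z := ‖∑ x ∈ Finset.Ico m n, unitExp (-(d / p) * x)‖
  have hZ : 0 ≤ Z := norm_nonneg _
  rw [mul_neg, Real.sin_neg, abs_neg] at hmain
  rw [mul_max_of_nonneg _ _ hp.le]
  have hpi := Real.pi_pos
  rcases le_total d (p - d) with h | h
  · apply le_max_of_le_left
    have hs : 2 * d / p ≤ |Real.sin (Real.pi * (d / p))| := by
      refine le_trans ?_ (le_abs_self _)
      have hd0 : 0 ≤ d := by linarith
      refine le_trans (le_of_eq ?_) (Real.mul_le_sin (by positivity) ?_)
      · field_simp
      · have : d / p ≤ 1 / 2 := by rw [div_le_iff₀ hp]; linarith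
        nlinarith
    have h1 : Z * (2 * d / p) ≤ 1 := (mul_le_mul_of_nonneg_left hs hZ).trans hmain
    rw [mul_div_assoc', div_le_one hp] at h1
    rw [mul_one_div, le_div_iff₀ (by linarith)]
    nlinarith
  · apply le_max_of_le_right
    have hs : 2 * (p - d) / p ≤ |Real.sin (Real.pi * (d / p))| := by
      refine le_trans ?_ (le_abs_self _)
      rw [← Real.sin_pi_sub]
      refine le_trans (le_of_eq ?_) (Real.mul_le_sin ?_ ?_)
      · field_simp
      · have : d / p ≤ 1 := by rw [div_le_one hp]; linarith
        nlinarith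
      · have : 1 / 2 ≤ d / p := by rw [le_div_iff₀ hp]; linarith
        nlinarith
    have h1 : Z * (2 * (p - d) / p) ≤ 1 := (mul_le_mul_of_nonneg_left hs hZ).trans hmain
    rw [mul_div_assoc', div_le_one hp] at h1
    rw [mul_one_div, le_div_iff₀ (by linarith)]
    nlinarith

/-- The sequence `(j + 1)^(-1/3)`. -/
noncomputable def invCubeRoot (j : ℕ) : ℝ := ((j : ℝ) + 1) ^ (-(1 / 3) : ℝ)

lemma invCubeRoot_pos (j : ℕ) : 0 < invCubeRoot j := by unfold invCubeRoot; positivity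

lemma invCubeRoot_pow_three (j : ℕ) : invCubeRoot j ^ 3 = 1 / ((j : ℝ) + 1) := by
  unfold invCubeRoot
  rw [← Real.rpow_natCast, ← Real.rpow_mul (by positivity)]
  norm_num
  rw [Real.rpow_neg_one]

lemma sum_invCubeRoot_pow_four_le (n : ℕ) :
    ∑ j ∈ Finset.range n, invCubeRoot j ^ 4 ≤ 4 := by
  have h : ∀ k : ℕ, ∑ j ∈ Finset.range (k + 1), invCubeRoot j ^ 4 ≤ 4 - 3 * invCubeRoot k := by
    intro k
    induction k with
    | zero => simp [invCubeRoot]; norm_num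
    | succ k ih =>
      rw [Finset.sum_range_succ]
      have ha := invCubeRoot_pos k
      have hb := invCubeRoot_pos (k + 1)
      have ha3 := invCubeRoot_pow_three k
      have hb3 := invCubeRoot_pow_three (k + 1)
      set a := invCubeRoot k
      set b := invCubeRoot (k + 1)
      have hdiff : a ^ 3 - b ^ 3 = a ^ 3 * b ^ 3 := by
        rw [ha3, hb3]; push_cast; field_simp; ring
      have hab : b ≤ a := by
        have : b ^ 3 ≤ a ^ 3 := by
          have : 0 < a ^ 3 * b ^ 3 := by positivity
          linarith
        exact le_of_pow_le_pow_left₀ (by norm_num) ha.le this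
      have h1 : a ^ 2 * (a * b ^ 3) ≤ a ^ 2 * (3 * (a - b)) := by
        calc a ^ 2 * (a * b ^ 3) = (a - b) * (a ^ 2 + a * b + b ^ 2) := by
              linear_combination -hdiff
          _ ≤ (a - b) * (3 * a ^ 2) := by
              apply mul_le_mul_of_nonneg_left _ (by linarith)
              nlinarith
          _ = _ := by ring
      have h2 := le_of_mul_le_mul_left h1 (by positivity)
      have h3 : b ^ 4 ≤ a * b ^ 3 := by
        calc b ^ 4 = b * b ^ 3 := by ring
          _ ≤ a * b ^ 3 := by gcongr
      linarith
  rcases n with _ | k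
  · simp
  · have := h k
    have := invCubeRoot_pos k
    linarith

lemma sum_zmod_eq_sum_range {p : ℕ} [NeZero p] {M : Type*} [AddCommMonoid M] (f : ZMod p → M)
    (c : ZMod p) : ∑ a, f a = ∑ j ∈ Finset.range p, f (c + (j : ZMod p)) := by
  rw [← Equiv.sum_comp (Equiv.addLeft c) f]
  symm
  refine Finset.sum_bij (fun j _ => (j : ZMod p)) (by simp) ?_ ?_ (by simp)
  · intro i hi j hj h
    rw [Finset.mem_range] at hi hj
    rw [← ZMod.val_cast_of_lt hi, ← ZMod.val_cast_of_lt hj, h]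
  · intro a _
    exact ⟨a.val, by simpa using ZMod.val_lt a, by simp⟩

lemma pow_three_mul_le (τ κ : ℝ) : τ ^ 3 * κ ≤ 3 / 5 * τ ^ 4 + 125 / 256 * κ ^ 4 := by
  nlinarith [mul_nonneg (sq_nonneg (τ - 5 / 4 * κ))
    (add_nonneg (sq_nonneg (τ + 5 / 4 * κ)) (sq_nonneg τ))]

/-- Completion of an incomplete Kloosterman sum. -/
lemma mul_sum_stdAddChar_inv_mul {p : ℕ} [Fact p.Prime] (b : ZMod p) (g : ℕ → ℂ) {I : Finset ℕ}
    (hI : ∀ x ∈ I, (x : ZMod p) ≠ 0) :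
    (p : ℂ) * ∑ x ∈ I, ZMod.stdAddChar (b * (x : ZMod p)⁻¹) * g x =
      ∑ a : ZMod p, kloostermanSum p a b * ∑ x ∈ I, ZMod.stdAddChar (-(a * (x : ZMod p))) * g x := by
  simp_rw [Finset.mul_sum]
  rw [Finset.sum_comm]
  refine Finset.sum_congr rfl fun x hx => ?_
  unfold kloostermanSum
  simp_rw [Finset.sum_mul]
  rw [Finset.sum_comm]
  have h1 : ∀ u : (ZMod p)ˣ, ∑ a : ZMod p,
      (ZMod.stdAddChar (a * (u : ZMod p) + b * ((u⁻¹ : (ZMod p)ˣ) : ZMod p)) : ℂ) *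
        (ZMod.stdAddChar (-(a * (x : ZMod p))) * g x) =
      if u = Units.mk0 _ (hI x hx) then p * (ZMod.stdAddChar (b * (x : ZMod p)⁻¹) * g x) else 0 := by
    intro u
    have h2 : ∀ a : ZMod p,
        (ZMod.stdAddChar (a * (u : ZMod p) + b * ((u⁻¹ : (ZMod p)ˣ) : ZMod p)) : ℂ) *
        (ZMod.stdAddChar (-(a * (x : ZMod p))) * g x) =
        ZMod.stdAddChar (a * ((u : ZMod p) - (x : ZMod p))) *
          (ZMod.stdAddChar (b * ((u⁻¹ : (ZMod p)ˣ) : ZMod p)) * g x) := by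
      intro a
      rw [← mul_assoc, ← mul_assoc, ← AddChar.map_add_eq_mul, ← AddChar.map_add_eq_mul]
      congr 2
      ring
    simp_rw [h2]
    rw [← Finset.sum_mul, AddChar.sum_mulShift _ (ZMod.isPrimitive_stdAddChar p), ZMod.card]
    have h3 : (u : ZMod p) - (x : ZMod p) = 0 ↔ u = Units.mk0 _ (hI x hx) := by
      rw [sub_eq_zero, Units.ext_iff, Units.val_mk0]
    by_cases h : u = Units.mk0 _ (hI x hx)
    · rw [if_pos (h3.2 h), if_pos h, h, Units.val_inv_eq_inv_val, Units.val_mk0]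
    · rw [if_neg (mt h3.1 h), if_neg h, Nat.cast_zero, zero_mul]
  simp_rw [h1]
  simp

/-- Incomplete Kloosterman sums twisted by a linear phase of arbitrary real frequency. -/
lemma norm_sum_stdAddChar_inv_mul_unitExp_le {p : ℕ} [Fact p.Prime] {P : ℝ} (hP : 0 < P)
    (hPp : P ^ 4 = p) {b : ZMod p} (hb : b ≠ 0) (α : ℝ) {m n : ℕ} (hm : 1 ≤ m) (hn : n ≤ p) :
    ‖∑ x ∈ Finset.Ico m n, ZMod.stdAddChar (b * (x : ZMod p)⁻¹) * unitExp (α / p * x)‖ ≤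
      6.3 * P ^ 3 := by
  have hp0 : (0 : ℝ) < p := by exact_mod_cast (Fact.out : p.Prime).pos
  have hI : ∀ x ∈ Finset.Ico m n, (x : ZMod p) ≠ 0 := by
    intro x hx h
    rw [Finset.mem_Ico] at hx
    rw [ZMod.natCast_eq_zero_iff] at h
    have := Nat.le_of_dvd (by omega) h
    omega
  have hcomp := mul_sum_stdAddChar_inv_mul b (fun x => unitExp (α / p * x)) hI
  rw [sum_zmod_eq_sum_range _ ((⌈α⌉ : ℤ) : ZMod p)] at hcomp
  have hD : ∀ j ∈ Finset.range p, ‖∑ x ∈ Finset.Ico m n,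
      (ZMod.stdAddChar (-((((⌈α⌉ : ℤ) : ZMod p) + (j : ZMod p)) * (x : ZMod p))) : ℂ) *
        unitExp (α / p * x)‖ ≤ p * max (invCubeRoot j) (invCubeRoot (p - 1 - j)) ^ 3 := by
    intro j hj
    rw [Finset.mem_range] at hj
    have h1 : ∀ x : ℕ, (ZMod.stdAddChar (-((((⌈α⌉ : ℤ) : ZMod p) + (j : ZMod p)) *
        (x : ZMod p))) : ℂ) * unitExp (α / p * x) = unitExp (-((⌈α⌉ + j - α) / p) * x) := by
      intro x
      have : (-((((⌈α⌉ : ℤ) : ZMod p) + (j : ZMod p)) * (x : ZMod p))) =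
          ((-((⌈α⌉ + j) * x) : ℤ) : ZMod p) := by push_cast; ring
      rw [this, stdAddChar_intCast_eq_unitExp, ← unitExp_add]
      congr 1
      push_cast
      ring
    simp_rw [h1]
    have h2 : 1 / ((p : ℝ) - j) = invCubeRoot (p - 1 - j) ^ 3 := by
      rw [invCubeRoot_pow_three, Nat.cast_sub (by omega), Nat.cast_sub (by omega)]
      congr 1
      push_cast
      ring
    refine (norm_sum_unitExp_le hj (by omega) (d := ⌈α⌉ + j - α) ?_ ?_).trans ?_
    · linarith [Int.le_ceil α]
    · linarith [Int.ceil_lt_add_one α]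
    · rw [h2, ← invCubeRoot_pow_three]
      gcongr
      exact max_le (pow_le_pow_left₀ (invCubeRoot_pos _).le (le_max_left _ _) 3)
        (pow_le_pow_left₀ (invCubeRoot_pos _).le (le_max_right _ _) 3)
  have hterm : ∀ j ∈ Finset.range p, ‖kloostermanSum p (((⌈α⌉ : ℤ) : ZMod p) + (j : ZMod p)) b *
      ∑ x ∈ Finset.Ico m n,
      (ZMod.stdAddChar (-((((⌈α⌉ : ℤ) : ZMod p) + (j : ZMod p)) * (x : ZMod p))) : ℂ) *
        unitExp (α / p * x)‖ ≤ p * P ^ 3 * (3 / 5 * (invCubeRoot j ^ 4 +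
          invCubeRoot (p - 1 - j) ^ 4) + 125 / 256 *
          (‖kloostermanSum p (((⌈α⌉ : ℤ) : ZMod p) + (j : ZMod p)) b‖ ^ 4 / (p : ℝ) ^ 3)) := by
    intro j hj
    rw [norm_mul]
    set κ := ‖kloostermanSum p (((⌈α⌉ : ℤ) : ZMod p) + (j : ZMod p)) b‖
    set τ := max (invCubeRoot j) (invCubeRoot (p - 1 - j)) with hτ
    have hτ4 : τ ^ 4 ≤ invCubeRoot j ^ 4 + invCubeRoot (p - 1 - j) ^ 4 := by
      have h1 := pow_pos (invCubeRoot_pos j) 4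
      have h2 := pow_pos (invCubeRoot_pos (p - 1 - j)) 4
      rcases max_choice (invCubeRoot j) (invCubeRoot (p - 1 - j)) with h | h <;>
        rw [hτ, h] <;> linarith
    have hκ : κ ^ 4 / (p : ℝ) ^ 3 = (κ / P ^ 3) ^ 4 := by
      rw [← hPp, div_pow]; congr 1; ring
    calc κ * _ ≤ κ * (p * τ ^ 3) := by gcongr; exact hD j hj
      _ = p * P ^ 3 * (τ ^ 3 * (κ / P ^ 3)) := by field_simp
      _ ≤ p * P ^ 3 * (3 / 5 * τ ^ 4 + 125 / 256 * (κ / P ^ 3) ^ 4) := by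
          gcongr; exact pow_three_mul_le _ _
      _ ≤ _ := by rw [hκ]; gcongr
  have hsum := norm_sum_le_of_le _ hterm
  rw [← hcomp, norm_mul, Complex.norm_natCast, ← Finset.mul_sum, Finset.sum_add_distrib,
    ← Finset.mul_sum, ← Finset.mul_sum, Finset.sum_add_distrib, ← Finset.sum_div,
    Finset.sum_range_reflect (fun j => invCubeRoot j ^ 4) p,
    ← sum_zmod_eq_sum_range (fun a => ‖kloostermanSum p a b‖ ^ 4) ((⌈α⌉ : ℤ) : ZMod p),
    mul_assoc] at hsum
  refine (le_of_mul_le_mul_left hsum hp0).trans ?_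
  rw [mul_comm]
  gcongr
  have h1 := sum_invCubeRoot_pow_four_le p
  have h2 : (∑ a : ZMod p, ‖kloostermanSum p a b‖ ^ 4) / (p : ℝ) ^ 3 ≤ 3 := by
    rw [div_le_iff₀ (by positivity)]
    exact sum_norm_kloostermanSum_pow_four_le hb
  linarith

/-- The `1`-periodic extension of the second Bernoulli polynomial. -/
noncomputable def periodicBernoulliTwo (t : ℝ) : ℝ := Int.fract t ^ 2 - Int.fract t + 1 / 6

lemma hasSum_periodicBernoulliTwo (t : ℝ) :
    HasSum (fun n : ℕ => 1 / (n : ℝ) ^ 2 * (unitExp (n * t)).re)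
      (Real.pi ^ 2 * periodicBernoulliTwo t) := by
  have h := hasSum_one_div_nat_pow_mul_cos (k := 1) one_ne_zero
    (x := Int.fract t) ⟨Int.fract_nonneg t, (Int.fract_lt_one t).le⟩
  convert! h using 1
  · funext n
    rw [unitExp_re, mul_one]
    congr 1
    have : 2 * Real.pi * (n * t) = 2 * Real.pi * n * Int.fract t + (n * ⌊t⌋ : ℤ) * (2 * Real.pi) := by
      conv_lhs => rw [← Int.fract_add_floor t]
      push_cast
      ring
    rw [this, Real.cos_add_int_mul_two_pi]
  · have h2 : (Polynomial.map (algebraMap ℚ ℝ) (Polynomial.bernoulli (2 * 1))).eval (Int.fract t) =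
        periodicBernoulliTwo t := by
      unfold periodicBernoulliTwo
      rw [Polynomial.bernoulli, mul_one, Finset.sum_range_succ, Finset.sum_range_succ,
        Finset.sum_range_one]
      simp [Polynomial.eval_add, bernoulli_two, bernoulli_one]
      ring
    rw [h2, show Nat.factorial (2 * 1) = 2 from rfl]
    push_cast
    ring

lemma periodicBernoulliTwo_add_le (t η : ℝ) :
    periodicBernoulliTwo (t + η) ≤
      periodicBernoulliTwo t + 2 * η * (Int.fract t - 1 / 2) + η ^ 2 := by
  have key : ∀ s : ℝ, Int.fract s ^ 2 - Int.fract s ≤ s ^ 2 - s := by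
    intro s
    have h0 := Int.fract_nonneg s
    have h1 := Int.fract_lt_one s
    by_cases hs : 0 ≤ s ∧ s < 1
    · rw [Int.fract_eq_self.2 hs]
    · have : 0 ≤ s ^ 2 - s := by
        by_contra! hlt
        apply hs
        constructor <;> nlinarith
      nlinarith
  have h : Int.fract (t + η) = Int.fract (Int.fract t + η) := by
    conv_lhs => rw [← Int.fract_add_floor t, add_right_comm]
    rw [Int.fract_add_intCast]
  have := key (Int.fract t + η)
  unfold periodicBernoulliTwo
  rw [h]
  nlinarith

section Sawtooth

variable {p N : ℕ} {M : ℝ} {t : ℕ → ℝ} {I : Finset ℕ}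

lemma abs_re_mul_sum_unitExp_le (hN : 1 ≤ N) (hcard : I.card ≤ p)
    (hM : ∀ n : ℕ, 1 ≤ n → n < p → ‖∑ x ∈ I, unitExp (n * t x)‖ ≤ M) (hM0 : 0 ≤ M) {η : ℝ}
    (hη : |η| = 1 / N) (n : ℕ) :
    |1 / (n : ℝ) ^ 2 * ((unitExp (n * η) - 1) * ∑ x ∈ I, unitExp (n * t x)).re| ≤
      2 * Real.pi * M / N * (if n ∈ Finset.Icc 1 N then (n : ℝ)⁻¹ else 0) +
        2 * M * (if N < n then ((n : ℝ) ^ 2)⁻¹ else 0) +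
        2 * p * (if p - 1 < n then ((n : ℝ) ^ 2)⁻¹ else 0) := by
  rcases Nat.eq_zero_or_pos n with rfl | hn
  · simp
  have hn0 : (0 : ℝ) < n := by exact_mod_cast hn
  have hN0 : (0 : ℝ) < N := by exact_mod_cast hN
  have hpi := Real.pi_pos
  rw [abs_mul, abs_of_pos (by positivity : 0 < 1 / (n : ℝ) ^ 2)]
  set A := ‖unitExp (n * η) - 1‖
  set S := ‖∑ x ∈ I, unitExp (n * t x)‖
  have hre : |((unitExp (n * η) - 1) * ∑ x ∈ I, unitExp (n * t x)).re| ≤ A * S :=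
    (Complex.abs_re_le_norm _).trans_eq (norm_mul _ _)
  have hA0 : 0 ≤ A := norm_nonneg _
  have hA2 : A ≤ 2 := norm_unitExp_sub_one_le_two _
  have hAn : A ≤ 2 * Real.pi * n / N := by
    refine (norm_unitExp_sub_one_le _).trans_eq ?_
    rw [abs_mul, hη, abs_of_pos hn0]; ring
  have hSp : S ≤ p := by
    refine (norm_sum_le _ _).trans ?_
    simp only [norm_unitExp, Finset.sum_const, nsmul_eq_mul, mul_one]
    exact_mod_cast hcard
  have e1 : 0 ≤ 2 * Real.pi * M / N * (if n ∈ Finset.Icc 1 N then (n : ℝ)⁻¹ else 0) := by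
    split_ifs <;> positivity
  have e2 : 0 ≤ 2 * M * (if N < n then ((n : ℝ) ^ 2)⁻¹ else 0) := by
    split_ifs <;> positivity
  have e3 : 0 ≤ 2 * (p : ℝ) * (if p - 1 < n then ((n : ℝ) ^ 2)⁻¹ else 0) := by
    split_ifs <;> positivity
  refine (mul_le_mul_of_nonneg_left hre (by positivity)).trans ?_
  rcases lt_or_ge n p with h | h
  · have hSM := hM n hn h
    rcases lt_or_ge N n with h' | h'
    · have : 1 / (n : ℝ) ^ 2 * (A * S) ≤ 2 * M * (if N < n then ((n : ℝ) ^ 2)⁻¹ else 0) := by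
        rw [if_pos h', one_div, mul_comm]
        gcongr
      linarith
    · have : 1 / (n : ℝ) ^ 2 * (A * S) ≤
          2 * Real.pi * M / N * (if n ∈ Finset.Icc 1 N then (n : ℝ)⁻¹ else 0) := by
        rw [if_pos (Finset.mem_Icc.2 ⟨hn, h'⟩)]
        calc 1 / (n : ℝ) ^ 2 * (A * S) ≤ 1 / (n : ℝ) ^ 2 * (2 * Real.pi * n / N * M) := by
              gcongr
          _ = _ := by field_simp
      linarith
  · have : 1 / (n : ℝ) ^ 2 * (A * S) ≤ 2 * p * (if p - 1 < n then ((n : ℝ) ^ 2)⁻¹ else 0) := by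
      rw [if_pos (by omega), one_div, mul_comm]
      gcongr
    linarith

lemma abs_sum_periodicBernoulliTwo_sub_le (hp : 1 ≤ p) (hN : 1 ≤ N) (hcard : I.card ≤ p)
    (hM : ∀ n : ℕ, 1 ≤ n → n < p → ‖∑ x ∈ I, unitExp (n * t x)‖ ≤ M) (hM0 : 0 ≤ M) {η : ℝ}
    (hη : |η| = 1 / N) :
    Real.pi ^ 2 * |∑ x ∈ I, (periodicBernoulliTwo (t x + η) - periodicBernoulliTwo (t x))| ≤
      2 * Real.pi * M / N * (1 + Real.log N) + 4 * M / N + 4 := by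
  have hN0 : (0 : ℝ) < N := by exact_mod_cast hN
  have hpi := Real.pi_pos
  have hs : HasSum (fun n : ℕ => 1 / (n : ℝ) ^ 2 *
      ((unitExp (n * η) - 1) * ∑ x ∈ I, unitExp (n * t x)).re)
      (Real.pi ^ 2 * ∑ x ∈ I, (periodicBernoulliTwo (t x + η) - periodicBernoulliTwo (t x))) := by
    rw [Finset.mul_sum]
    convert! hasSum_sum (s := I) fun x _ =>
      (hasSum_periodicBernoulliTwo (t x + η)).sub (hasSum_periodicBernoulliTwo (t x)) using 1
    · funext n
      rw [Finset.mul_sum, Complex.re_sum, Finset.mul_sum]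
      refine Finset.sum_congr rfl fun x _ => ?_
      rw [mul_add (n : ℝ), unitExp_add, ← mul_sub, ← Complex.sub_re]
      congr 2
      ring
    · refine Finset.sum_congr rfl fun x _ => by ring
  rw [← abs_of_pos (by positivity : 0 < Real.pi ^ 2), ← abs_mul]
  refine le_of_tendsto hs.tendsto_sum_nat.abs (Filter.Eventually.of_forall fun k => ?_)
  refine (Finset.abs_sum_le_sum_abs _ _).trans ?_
  refine (Finset.sum_le_sum fun n _ =>
    abs_re_mul_sum_unitExp_le hN hcard hM hM0 hη n).trans ?_
  rw [Finset.sum_add_distrib, Finset.sum_add_distrib, ← Finset.mul_sum, ← Finset.mul_sum,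
    ← Finset.mul_sum, ← Finset.sum_filter, ← Finset.sum_filter, ← Finset.sum_filter]
  have tail : ∀ m : ℕ, ∑ n ∈ Finset.range k with m < n, ((n : ℝ) ^ 2)⁻¹ ≤ 2 / (m + 1) := by
    intro m
    refine le_trans (le_of_eq ?_) (sum_Ioo_inv_sq_le m k)
    congr 1
    ext n
    simp only [Finset.mem_filter, Finset.mem_range, Finset.mem_Ioo]
    omega
  have h1 : ∑ n ∈ Finset.range k with n ∈ Finset.Icc 1 N, (n : ℝ)⁻¹ ≤ 1 + Real.log N := by
    refine le_trans ?_ (harmonic_le_one_add_log N)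
    rw [harmonic_eq_sum_Icc]
    push_cast
    exact Finset.sum_le_sum_of_subset_of_nonneg (fun n hn => (Finset.mem_filter.1 hn).2)
      fun n _ _ => by positivity
  have h2 : 2 * M * ∑ n ∈ Finset.range k with N < n, ((n : ℝ) ^ 2)⁻¹ ≤ 4 * M / N := by
    calc _ ≤ 2 * M * (2 / (N + 1)) := by gcongr; exact tail N
      _ ≤ 2 * M * (2 / N) := by gcongr; linarith
      _ = _ := by ring
  have h3 : 2 * (p : ℝ) * ∑ n ∈ Finset.range k with p - 1 < n, ((n : ℝ) ^ 2)⁻¹ ≤ 4 := by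
    have hp0 : (0 : ℝ) < p := by exact_mod_cast hp
    calc _ ≤ 2 * (p : ℝ) * (2 / ((p - 1 : ℕ) + 1)) := by gcongr; exact tail (p - 1)
      _ = 4 := by
        rw [Nat.cast_sub hp, Nat.cast_one, sub_add_cancel]
        field_simp
        norm_num
  have h4 : 2 * Real.pi * M / N * ∑ n ∈ Finset.range k with n ∈ Finset.Icc 1 N, (n : ℝ)⁻¹ ≤
      2 * Real.pi * M / N * (1 + Real.log N) := by gcongr
  linarith

/-- A sawtooth sum over points whose exponential sums are bounded by `M`. -/
lemma abs_sum_fract_sub_half_le (hp : 1 ≤ p) (hN : 1 ≤ N) (hcard : I.card ≤ p)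
    (hM : ∀ n : ℕ, 1 ≤ n → n < p → ‖∑ x ∈ I, unitExp (n * t x)‖ ≤ M) (hM0 : 0 ≤ M) :
    |∑ x ∈ I, (Int.fract (t x) - 1 / 2)| ≤
      p / (2 * N) + M * (1 + Real.log N) / 3 + 2 * M / 9 + 2 * N / 9 := by
  have hN1 : (1 : ℝ) ≤ N := by exact_mod_cast hN
  have hN0 : (0 : ℝ) < N := by linarith
  have hlog : 0 ≤ Real.log N := Real.log_nonneg hN1
  have hpi := Real.pi_gt_three
  have hB : ∀ η : ℝ, |η| = 1 / N →
      |∑ x ∈ I, (periodicBernoulliTwo (t x + η) - periodicBernoulliTwo (t x))| ≤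
      2 / N * (M * (1 + Real.log N) / 3 + 2 * M / 9 + 2 * N / 9) := by
    intro η hη
    have h := abs_sum_periodicBernoulliTwo_sub_le hp hN hcard hM hM0 hη
    rw [mul_comm, ← le_div_iff₀ (by positivity)] at h
    refine h.trans ?_
    have e : (2 * Real.pi * M / N * (1 + Real.log N) + 4 * M / N + 4) / Real.pi ^ 2 =
        2 / N * (M * (1 + Real.log N) / Real.pi + 2 * M / Real.pi ^ 2 + 2 * N / Real.pi ^ 2) := by
      field_simp
      ring
    rw [e]
    have h9 : (9 : ℝ) ≤ Real.pi ^ 2 := by nlinarith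
    gcongr
  have hsum : ∀ η : ℝ, |η| = 1 / N →
      -(2 * η * ∑ x ∈ I, (Int.fract (t x) - 1 / 2)) ≤
      2 / N * (M * (1 + Real.log N) / 3 + 2 * M / 9 + 2 * N / 9) + p * (1 / N) ^ 2 := by
    intro η hη
    have h1 := (abs_le.1 (hB η hη)).1
    have h2 : ∑ x ∈ I, (periodicBernoulliTwo (t x + η) - periodicBernoulliTwo (t x)) ≤
        2 * η * ∑ x ∈ I, (Int.fract (t x) - 1 / 2) + p * (1 / N) ^ 2 := by
      calc _ ≤ ∑ x ∈ I, (2 * η * (Int.fract (t x) - 1 / 2) + (1 / (N : ℝ)) ^ 2) := by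
            refine Finset.sum_le_sum fun x _ => ?_
            have := periodicBernoulliTwo_add_le (t x) η
            rw [← hη, sq_abs]
            linarith
        _ = 2 * η * ∑ x ∈ I, (Int.fract (t x) - 1 / 2) + I.card * (1 / (N : ℝ)) ^ 2 := by
            rw [Finset.sum_add_distrib, ← Finset.mul_sum, Finset.sum_const, nsmul_eq_mul]
        _ ≤ _ := by gcongr
    linarith
  have hpos := hsum (1 / N) (abs_of_pos (by positivity))
  have hneg := hsum (-(1 / N)) (by rw [abs_neg, abs_of_pos (by positivity)])
  set W := M * (1 + Real.log N) / 3 + 2 * M / 9 + 2 * N / 9 with hW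
  set T := ∑ x ∈ I, (Int.fract (t x) - 1 / 2)
  have e : 2 / N * W + p * (1 / N) ^ 2 = 2 / N * (p / (2 * N) + W) := by
    field_simp
    ring
  have hle : ∀ s : ℝ, 2 / N * s ≤ 2 / N * W + p * (1 / N) ^ 2 → s ≤ p / (2 * N) + W := by
    intro s hs
    rw [e] at hs
    exact le_of_mul_le_mul_left hs (by positivity)
  have h1 := hle (-T) (by refine le_trans (le_of_eq ?_) hpos; ring)
  have h2 := hle T (by refine le_trans (le_of_eq ?_) hneg; ring)
  rw [abs_le]
  constructor <;> linarith

end Sawtooth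

/-- The least nonnegative inverse of `x` modulo `p`. -/
noncomputable def invMod (p x : ℕ) : ℕ := ((x : ZMod p)⁻¹).val

/-- The bound for sawtooth sums over modular inverses along a line, with a free parameter `N`. -/
noncomputable def sawtoothBound (p N : ℕ) (P : ℝ) : ℝ :=
  p / (2 * N) + 6.3 * P ^ 3 * (1 + Real.log N) / 3 + 2 * (6.3 * P ^ 3) / 9 + 2 * N / 9

section Counting

variable {p N : ℕ} [Fact p.Prime] {P : ℝ}

lemma abs_sum_fract_invMod_le (hP : 0 < P) (hPp : P ^ 4 = p) (hN : 1 ≤ N) {ε : ℤ}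
    (hε : ε = 1 ∨ ε = -1) (u₀ u₁ : ℝ) {m n : ℕ} (hm : 1 ≤ m) (hn : n ≤ p) :
    |∑ x ∈ Finset.Ico m n, (Int.fract (ε * (invMod p x - (u₀ + u₁ * x)) / p) - 1 / 2)| ≤
      sawtoothBound p N P := by
  refine abs_sum_fract_sub_half_le (M := 6.3 * P ^ 3)
    (Fact.out : p.Prime).one_lt.le hN (by simp; omega) ?_ (by positivity)
  intro k hk hkp
  have hk0 : ((k * ε : ℤ) : ZMod p) ≠ 0 := by
    have hk1 : (k : ZMod p) ≠ 0 := by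
      rw [Ne, ZMod.natCast_eq_zero_iff]
      exact fun h => absurd (Nat.le_of_dvd (by omega) h) (by omega)
    rcases hε with rfl | rfl <;> simpa using hk1
  have key : ∀ x : ℕ, unitExp (k * (ε * (invMod p x - (u₀ + u₁ * x)) / p)) =
      unitExp (-(k * ε * u₀) / p) * (ZMod.stdAddChar (((k * ε : ℤ) : ZMod p) * (x : ZMod p)⁻¹) *
        unitExp (-(k * ε * u₁) / p * x)) := by
    intro x
    have h1 : ((k * ε : ℤ) : ZMod p) * (x : ZMod p)⁻¹ = ((k * ε * invMod p x : ℤ) : ZMod p) := by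
      push_cast
      rw [invMod, ZMod.natCast_zmod_val]
    rw [h1, stdAddChar_intCast_eq_unitExp, ← unitExp_add, ← unitExp_add]
    congr 1
    push_cast
    ring
  simp_rw [key]
  rw [← Finset.mul_sum, norm_mul, norm_unitExp, one_mul]
  exact norm_sum_stdAddChar_inv_mul_unitExp_le hP hPp hk0 _ hm hn

lemma floor_div_eq_ite {z q : ℝ} (h1 : -q ≤ z) (h2 : z < q) (hq : 0 < q) :
    ⌊z / q⌋ = if 0 ≤ z then 0 else -1 := by
  split_ifs with h
  · rw [Int.floor_eq_iff]
    push_cast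
    constructor
    · positivity
    · rw [zero_add, div_lt_one hq]; exact h2
  · rw [Int.floor_eq_iff]
    push_cast
    constructor
    · rw [le_div_iff₀ hq]; linarith
    · rw [neg_add_cancel]; exact div_neg_of_neg_of_pos (not_le.1 h) hq

lemma ite_mem_Icc_eq_fract {u v y q : ℝ} (hy0 : 0 < y) (hyq : y < q) (hu : 0 ≤ u) (huv : u ≤ v)
    (hv : v < q) :
    (if u ≤ y ∧ y ≤ v then (1 : ℝ) else 0) = (v - u) / q -
      (Int.fract ((v - y) / q) - 1 / 2) - (Int.fract ((y - u) / q) - 1 / 2) := by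
  have hq : 0 < q := by linarith
  rw [← Int.self_sub_floor, ← Int.self_sub_floor,
    floor_div_eq_ite (by linarith) (by linarith) hq,
    floor_div_eq_ite (by linarith) (by linarith) hq]
  simp only [sub_nonneg]
  by_cases h1 : u ≤ y <;> by_cases h2 : y ≤ v
  · rw [if_pos ⟨h1, h2⟩, if_pos h1, if_pos h2]; push_cast; ring
  · rw [if_neg (fun h => h2 h.2), if_pos h1, if_neg h2]; push_cast; ring
  · rw [if_neg (fun h => h1 h.1), if_neg h1, if_pos h2]; push_cast; ring
  · linarith

lemma invMod_lt (x : ℕ) : invMod p x < p := ZMod.val_lt _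

lemma natCast_ne_zero_of_lt {x : ℕ} (h1 : 1 ≤ x) (h2 : x < p) : (x : ZMod p) ≠ 0 := by
  rw [Ne, ZMod.natCast_eq_zero_iff]
  exact fun h => absurd (Nat.le_of_dvd (by omega) h) (by omega)

lemma invMod_pos {x : ℕ} (h1 : 1 ≤ x) (h2 : x < p) : 0 < invMod p x := by
  rw [invMod, ZMod.val_pos]
  exact inv_ne_zero (natCast_ne_zero_of_lt h1 h2)

open Finset in
lemma abs_card_invMod_sub_sum_le (hP : 0 < P) (hPp : P ^ 4 = p) (hN : 1 ≤ N)
    (u₀ u₁ v₀ v₁ : ℝ) {m n : ℕ} (hm : 1 ≤ m) (hn : n ≤ p)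
    (hu : ∀ x ∈ Ico m n, 0 ≤ u₀ + u₁ * (x : ℝ))
    (huv : ∀ x ∈ Ico m n, u₀ + u₁ * (x : ℝ) ≤ v₀ + v₁ * x)
    (hv : ∀ x ∈ Ico m n, v₀ + v₁ * (x : ℝ) < p) :
    |(#{x ∈ Ico m n | u₀ + u₁ * ((x : ℕ) : ℝ) ≤ invMod p x ∧ (invMod p x : ℝ) ≤ v₀ + v₁ * x} : ℝ) -
      (∑ x ∈ Ico m n, ((v₀ - u₀) + (v₁ - u₁) * (x : ℝ))) / p| ≤ 2 * sawtoothBound p N P := by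
  have h1 := abs_sum_fract_invMod_le hP hPp hN (Or.inr rfl) v₀ v₁ hm hn
  have h2 := abs_sum_fract_invMod_le hP hPp hN (Or.inl rfl) u₀ u₁ hm hn
  have h : (#{x ∈ Ico m n | u₀ + u₁ * ((x : ℕ) : ℝ) ≤ invMod p x ∧ (invMod p x : ℝ) ≤ v₀ + v₁ * x} : ℝ) -
      (∑ x ∈ Ico m n, ((v₀ - u₀) + (v₁ - u₁) * (x : ℝ))) / p =
      -(∑ x ∈ Ico m n,
        (Int.fract (((-1 : ℤ) : ℝ) * (invMod p x - (v₀ + v₁ * x)) / p) - 1 / 2)) -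
      ∑ x ∈ Ico m n, (Int.fract (((1 : ℤ) : ℝ) * (invMod p x - (u₀ + u₁ * x)) / p) - 1 / 2) := by
    rw [card_filter, sum_div, Nat.cast_sum, ← sum_sub_distrib, ← sum_neg_distrib,
      ← sum_sub_distrib]
    refine sum_congr rfl fun x hx => ?_
    have hx' := mem_Ico.1 hx
    have h3 := ite_mem_Icc_eq_fract (u := u₀ + u₁ * (x : ℝ)) (v := v₀ + v₁ * x)
      (y := invMod p x) (q := p)
      (by exact_mod_cast invMod_pos (hm.trans hx'.1) (hx'.2.trans_le hn))
      (by exact_mod_cast invMod_lt x) (hu x hx) (huv x hx) (hv x hx)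
    push_cast
    rw [h3, show (-1 : ℝ) * (invMod p x - (v₀ + v₁ * x)) = v₀ + v₁ * x - invMod p x by ring, one_mul]
    ring
  rw [h]
  rw [abs_le] at h1 h2 ⊢
  constructor <;> linarith [h1.1, h1.2, h2.1, h2.2]

end Counting

lemma sum_Ico_affine (f₀ f₁ : ℝ) {m n : ℕ} (h : m ≤ n) :
    ∑ x ∈ Finset.Ico m n, (f₀ + f₁ * (x : ℝ)) = (n - m) * (f₀ + f₁ * ((m : ℝ) + n - 1) / 2) := by
  induction n, h using Nat.le_induction with
  | base => simp
  | succ k hk ih =>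
    rw [Finset.sum_Ico_succ_top hk, ih]
    push_cast
    ring

/-- Comparison of an affine function's sum over the positive integers of an interval with its
integral. -/
lemma abs_integral_affine_sub_sum_le {f₀ f₁ X₀ X₁ B : ℝ} (hX₀ : 0 ≤ X₀) (hX : X₀ ≤ X₁)
    (hf : ∀ x ∈ Set.Icc X₀ X₁, 0 ≤ f₀ + f₁ * x) (hB : ∀ x ∈ Set.Icc X₀ X₁, f₀ + f₁ * x ≤ B) :
    |∑ x ∈ Finset.Ico (max 1 ⌈X₀⌉₊) (⌊X₁⌋₊ + 1), (f₀ + f₁ * (x : ℝ)) -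
      (X₁ - X₀) * (f₀ + f₁ * ((X₀ + X₁) / 2))| ≤ 2 * B := by
  have hmid : ∀ a ∈ Set.Icc X₀ X₁, ∀ b ∈ Set.Icc X₀ X₁, (a + b) / 2 ∈ Set.Icc X₀ X₁ :=
    fun a ha b hb => ⟨by linarith [ha.1, hb.1], by linarith [ha.2, hb.2]⟩
  have hl : X₀ ∈ Set.Icc X₀ X₁ := ⟨le_rfl, hX⟩
  have hr : X₁ ∈ Set.Icc X₀ X₁ := ⟨hX, le_rfl⟩
  have hB0 : 0 ≤ B := (hf _ hl).trans (hB _ hl)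
  have hm1 : ((max 1 ⌈X₀⌉₊ : ℕ) : ℝ) ≤ X₀ + 1 := by
    rw [Nat.cast_max]
    refine max_le (by push_cast; linarith) (Nat.ceil_lt_add_one hX₀).le
  have hm0 : X₀ ≤ ((max 1 ⌈X₀⌉₊ : ℕ) : ℝ) := by
    rw [Nat.cast_max]
    exact (Nat.le_ceil _).trans (le_max_right _ _)
  have hn0 : (⌊X₁⌋₊ : ℝ) ≤ X₁ := Nat.floor_le (hX₀.trans hX)
  have hn1 : X₁ < (⌊X₁⌋₊ : ℝ) + 1 := Nat.lt_floor_add_one _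
  set m := max 1 ⌈X₀⌉₊
  set n := ⌊X₁⌋₊
  have hpiece : ∀ w a b : ℝ, 0 ≤ w → w ≤ 1 → a ∈ Set.Icc X₀ X₁ → b ∈ Set.Icc X₀ X₁ →
      0 ≤ w * (f₀ + f₁ * ((a + b) / 2)) ∧ w * (f₀ + f₁ * ((a + b) / 2)) ≤ B := by
    intro w a b h0 h1 ha hb
    have h2 := hf _ (hmid a ha b hb)
    have h3 := hB _ (hmid a ha b hb)
    exact ⟨mul_nonneg h0 h2, by nlinarith⟩
  rcases le_or_gt m n with h | h
  · have hmn : (m : ℝ) ≤ n := by exact_mod_cast h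
    have hmI : (m : ℝ) ∈ Set.Icc X₀ X₁ := ⟨hm0, by linarith⟩
    have hnI : (n : ℝ) ∈ Set.Icc X₀ X₁ := ⟨by linarith, hn0⟩
    rw [sum_Ico_affine _ _ (by omega)]
    have h1 := hpiece (X₁ - n) X₁ n (by linarith) (by linarith) hr hnI
    have h2 := hpiece (m - X₀) X₀ m (by linarith) (by linarith) hl hmI
    have h3 := hpiece 1 m n (by norm_num) le_rfl hmI hnI
    have e : (((n + 1 : ℕ) : ℝ) - m) * (f₀ + f₁ * ((m : ℝ) + (n + 1 : ℕ) - 1) / 2) -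
        (X₁ - X₀) * (f₀ + f₁ * ((X₀ + X₁) / 2)) = 1 * (f₀ + f₁ * ((m + n) / 2)) -
        (X₁ - n) * (f₀ + f₁ * ((X₁ + n) / 2)) - (m - X₀) * (f₀ + f₁ * ((X₀ + m) / 2)) := by
      push_cast
      ring
    rw [e, abs_le]
    constructor <;> linarith [h1.1, h1.2, h2.1, h2.2, h3.1, h3.2]
  · have hnm : (n : ℝ) + 1 ≤ m := by exact_mod_cast h
    rw [Finset.Ico_eq_empty_of_le (by omega), Finset.sum_empty, zero_sub, abs_neg]
    have h1 := hpiece (X₁ - X₀) X₀ X₁ (by linarith) (by linarith) hl hr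
    rw [abs_of_nonneg h1.1]
    linarith [h1.2]

/-- The region between two lines over the interval `[X₀, X₁]`. -/
def affineRegion (X₀ X₁ u₀ u₁ v₀ v₁ : ℝ) : Set (ℝ × ℝ) :=
  {z | z.1 ∈ Set.Icc X₀ X₁ ∧ z.2 ∈ Set.Icc (u₀ + u₁ * z.1) (v₀ + v₁ * z.1)}

lemma volume_affineRegion {X₀ X₁ u₀ u₁ v₀ v₁ : ℝ} (hX : X₀ ≤ X₁)
    (huv : ∀ x ∈ Set.Icc X₀ X₁, u₀ + u₁ * x ≤ v₀ + v₁ * x) :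
    (volume (affineRegion X₀ X₁ u₀ u₁ v₀ v₁)).toReal =
      (X₁ - X₀) * ((v₀ - u₀) + (v₁ - u₁) * ((X₀ + X₁) / 2)) := by
  have hclosed : IsClosed (affineRegion X₀ X₁ u₀ u₁ v₀ v₁) := by
    have : affineRegion X₀ X₁ u₀ u₁ v₀ v₁ = ({z | X₀ ≤ z.1} ∩ {z | z.1 ≤ X₁}) ∩
        ({z | u₀ + u₁ * z.1 ≤ z.2} ∩ {z | z.2 ≤ v₀ + v₁ * z.1}) := rfl
    rw [this]
    refine ((isClosed_le ?_ ?_).inter (isClosed_le ?_ ?_)).inter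
      ((isClosed_le ?_ ?_).inter (isClosed_le ?_ ?_)) <;> fun_prop
  rw [Measure.volume_eq_prod, Measure.prod_apply hclosed.measurableSet]
  have hslice : ∀ x : ℝ, volume (Prod.mk x ⁻¹' affineRegion X₀ X₁ u₀ u₁ v₀ v₁) =
      (Set.Icc X₀ X₁).indicator
        (fun x => ENNReal.ofReal ((v₀ - u₀) + (v₁ - u₁) * x)) x := by
    intro x
    by_cases hx : x ∈ Set.Icc X₀ X₁
    · rw [Set.indicator_of_mem hx]
      have : Prod.mk x ⁻¹' affineRegion X₀ X₁ u₀ u₁ v₀ v₁ =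
          Set.Icc (u₀ + u₁ * x) (v₀ + v₁ * x) := by
        ext y
        exact ⟨fun h => h.2, fun h => ⟨hx, h⟩⟩
      rw [this, Real.volume_Icc]
      congr 1
      ring
    · rw [Set.indicator_of_notMem hx]
      have : Prod.mk x ⁻¹' affineRegion X₀ X₁ u₀ u₁ v₀ v₁ = ∅ := by
        ext y
        exact ⟨fun h => hx h.1, fun h => h.elim⟩
      rw [this, measure_empty]
  simp_rw [hslice]
  have hcont : Continuous fun x : ℝ => (v₀ - u₀) + (v₁ - u₁) * x := by fun_prop
  have hnn : ∀ x ∈ Set.Icc X₀ X₁, 0 ≤ (v₀ - u₀) + (v₁ - u₁) * x := fun x hx => by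
    linarith [huv x hx]
  rw [lintegral_indicator measurableSet_Icc, ← ofReal_integral_eq_lintegral_ofReal
    hcont.continuousOn.integrableOn_Icc
    ((ae_restrict_iff' measurableSet_Icc).2 (Filter.Eventually.of_forall hnn)),
    integral_Icc_eq_integral_Ioc, ← intervalIntegral.integral_of_le hX]
  have hint : ∫ x in X₀..X₁, ((v₀ - u₀) + (v₁ - u₁) * x) =
      (X₁ - X₀) * ((v₀ - u₀) + (v₁ - u₁) * ((X₀ + X₁) / 2)) := by
    rw [intervalIntegral.integral_add (f := fun _ => v₀ - u₀) (g := fun x => (v₁ - u₁) * x)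
      intervalIntegrable_const (Continuous.intervalIntegrable (by fun_prop) _ _),
      intervalIntegral.integral_const,
      intervalIntegral.integral_const_mul, integral_id, smul_eq_mul]
    ring
  rw [hint, ENNReal.toReal_ofReal]
  exact mul_nonneg (by linarith) (hnn _ ⟨by linarith, by linarith⟩)

open Finset in
lemma invCount_affineRegion {p : ℕ} [Fact p.Prime] {X₀ X₁ u₀ u₁ v₀ v₁ : ℝ} (hX₀ : 0 ≤ X₀)
    (hX : X₀ ≤ X₁) (hX₁ : X₁ < p) (hv : ∀ x ∈ Set.Icc X₀ X₁, v₀ + v₁ * x < p) :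
    invCount p (affineRegion X₀ X₁ u₀ u₁ v₀ v₁) =
      #{x ∈ Ico (max 1 ⌈X₀⌉₊) (⌊X₁⌋₊ + 1) | u₀ + u₁ * ((x : ℕ) : ℝ) ≤ invMod p x ∧
        (invMod p x : ℝ) ≤ v₀ + v₁ * (x : ℝ)} := by
  have hX₁0 : 0 ≤ X₁ := hX₀.trans hX
  rw [← card_image_of_injective (f := fun x : ℕ => (x, invMod p x)) _
    (fun a b h => congrArg Prod.fst h), ← Set.ncard_coe_finset]
  unfold invCount
  congr 1
  ext ⟨x, y⟩
  simp only [Set.mem_ofPred_eq, coe_image, Set.mem_image, mem_coe, mem_filter, mem_Ico,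
    Prod.mk.injEq, affineRegion, Set.mem_Icc, max_le_iff, Nat.lt_succ_iff, Nat.ceil_le]
  have hmod : x * y ≡ 1 [MOD p] ↔ (x : ZMod p) * (y : ZMod p) = 1 := by
    rw [← ZMod.natCast_eq_natCast_iff]
    push_cast
    rfl
  constructor
  · rintro ⟨hx, hy, ⟨⟨hx0, hx1⟩, hyu, hyv⟩, hxy⟩
    have hyp : y < p := by exact_mod_cast hyv.trans_lt (hv x ⟨hx0, hx1⟩)
    have hinv : invMod p x = y := by
      rw [invMod, ← eq_inv_of_mul_eq_one_right (hmod.1 hxy), ZMod.val_cast_of_lt hyp]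
    refine ⟨x, ⟨⟨⟨hx, hx0⟩, Nat.le_floor hx1⟩, ?_⟩, rfl, hinv⟩
    rw [hinv]
    exact ⟨hyu, hyv⟩
  · rintro ⟨x', ⟨⟨⟨hx, hx0⟩, hx1⟩, hyu, hyv⟩, rfl, rfl⟩
    have hx1' : (x' : ℝ) ≤ X₁ := (Nat.le_floor_iff hX₁0).1 hx1
    have hxp : x' < p := by exact_mod_cast hx1'.trans_lt hX₁
    refine ⟨hx, invMod_pos hx hxp, ⟨⟨hx0, hx1'⟩, hyu, hyv⟩, ?_⟩
    rw [hmod, invMod, ZMod.natCast_zmod_val]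
    exact mul_inv_cancel₀ (natCast_ne_zero_of_lt hx hxp)

lemma exp_five_halves_mem_Icc : Real.exp (5 / 2) ∈ Set.Icc (12 : ℝ) 12.2 := by
  have h : Real.exp (5 / 2) ^ 2 = Real.exp 1 ^ 5 := by
    rw [← Real.exp_nat_mul, ← Real.exp_nat_mul]
    norm_num
  have h0 := Real.exp_pos (5 / 2)
  have hlo : (2.718 : ℝ) ^ 5 ≤ Real.exp 1 ^ 5 :=
    pow_le_pow_left₀ (by norm_num) (by linarith [Real.exp_one_gt_d9]) 5
  have hhi : Real.exp 1 ^ 5 ≤ (2.7183 : ℝ) ^ 5 :=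
    pow_le_pow_left₀ (Real.exp_pos 1).le (by linarith [Real.exp_one_lt_d9]) 5
  constructor
  · refine le_of_pow_le_pow_left₀ two_ne_zero h0.le ?_
    rw [h]
    exact le_trans (by norm_num) hlo
  · refine le_of_pow_le_pow_left₀ two_ne_zero (by norm_num) ?_
    rw [h]
    exact hhi.trans (by norm_num)

lemma exp_le_twelve_mul {t : ℝ} (h0 : 1 / 6 ≤ t) (h1 : t ≤ 5 / 2) : Real.exp t ≤ 12 * t := by
  have h := convexOn_exp.2 (Set.mem_univ 0) (Set.mem_univ (5 / 2))
    (show 0 ≤ 1 - t / (5 / 2) by linarith) (show 0 ≤ t / (5 / 2) by linarith) (by ring)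
  simp only [smul_eq_mul, Real.exp_zero] at h
  rw [show (1 - t / (5 / 2)) * 0 + t / (5 / 2) * (5 / 2) = t by ring] at h
  have := exp_five_halves_mem_Icc.2
  nlinarith

lemma abs_invCount_affineRegion_sub_lt {p : ℕ} (hp : p.Prime) {X₀ X₁ u₀ u₁ v₀ v₁ : ℝ}
    (hX₀ : 0 ≤ X₀) (hX : X₀ ≤ X₁) (hX₁ : X₁ ≤ p - 1) (hu : ∀ x ∈ Set.Icc X₀ X₁, 0 ≤ u₀ + u₁ * x)
    (huv : ∀ x ∈ Set.Icc X₀ X₁, u₀ + u₁ * x ≤ v₀ + v₁ * x)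
    (hv : ∀ x ∈ Set.Icc X₀ X₁, v₀ + v₁ * x ≤ p - 1) :
    |(invCount p (affineRegion X₀ X₁ u₀ u₁ v₀ v₁) : ℝ) -
      (volume (affineRegion X₀ X₁ u₀ u₁ v₀ v₁)).toReal / p| <
      3 * (p : ℝ) ^ ((3 : ℝ) / 4) * Real.log p := by
  have : Fact p.Prime := ⟨hp⟩
  have hp2 : (2 : ℝ) ≤ p := by exact_mod_cast hp.two_le
  have hp0 : (0 : ℝ) < p := by linarith
  set L := Real.log p with hL
  set P := Real.exp (L / 4) with hPdef
  have hP : 0 < P := Real.exp_pos _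
  have hPp : P ^ 4 = p := by
    rw [hPdef, ← Real.exp_nat_mul, ← Real.exp_log hp0]
    congr 1
    push_cast
    ring
  have hP3 : (p : ℝ) ^ ((3 : ℝ) / 4) = P ^ 3 := by
    rw [Real.rpow_def_of_pos hp0, hPdef, ← Real.exp_nat_mul]
    congr 1
    push_cast
    ring
  have hX₁0 : 0 ≤ X₁ := hX₀.trans hX
  have hnp : ⌊X₁⌋₊ + 1 ≤ p := by
    have h := Nat.floor_le hX₁0
    have : ((⌊X₁⌋₊ + 1 : ℕ) : ℝ) ≤ p := by push_cast; linarith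
    exact_mod_cast this
  rw [invCount_affineRegion hX₀ hX (by linarith) (fun x hx => by linarith [hv x hx]),
    volume_affineRegion hX huv, hP3]
  have hmid : (X₀ + X₁) / 2 ∈ Set.Icc X₀ X₁ := ⟨by linarith, by linarith⟩
  have hf : ∀ x ∈ Set.Icc X₀ X₁, 0 ≤ (v₀ - u₀) + (v₁ - u₁) * x := fun x hx => by
    linarith [huv x hx]
  have hfB : ∀ x ∈ Set.Icc X₀ X₁, (v₀ - u₀) + (v₁ - u₁) * x ≤ p - 1 := fun x hx => by
    linarith [hv x hx, hu x hx]
  rcases lt_or_ge L 10 with hL10 | hL10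
  · have hP3L : P ≤ 3 * L := by
      have h2 : Real.log 2 ≤ L := Real.log_le_log (by norm_num) hp2
      have := exp_le_twelve_mul (t := L / 4) (by linarith [Real.log_two_gt_d9]) (by linarith)
      linarith
    have hcard := (Finset.card_filter_le (Finset.Ico (max 1 ⌈X₀⌉₊) (⌊X₁⌋₊ + 1)) fun x : ℕ =>
      u₀ + u₁ * (x : ℝ) ≤ invMod p x ∧ (invMod p x : ℝ) ≤ v₀ + v₁ * (x : ℝ))
    rw [Nat.card_Ico] at hcard
    set c := (Finset.filter (fun x : ℕ =>
      u₀ + u₁ * (x : ℝ) ≤ invMod p x ∧ (invMod p x : ℝ) ≤ v₀ + v₁ * (x : ℝ))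
      (Finset.Ico (max 1 ⌈X₀⌉₊) (⌊X₁⌋₊ + 1))).card
    have hc1 : c + 1 ≤ p := by
      have := le_max_left 1 ⌈X₀⌉₊
      omega
    have hc : (c : ℝ) + 1 ≤ p := by exact_mod_cast hc1
    have hc0 : (0 : ℝ) ≤ c := Nat.cast_nonneg _
    have ha0 := hf _ hmid
    have ha1 := hfB _ hmid
    have hdiv0 : 0 ≤ (X₁ - X₀) * ((v₀ - u₀) + (v₁ - u₁) * ((X₀ + X₁) / 2)) / p :=
      div_nonneg (mul_nonneg (by linarith) ha0) hp0.le
    have hdiv1 : (X₁ - X₀) * ((v₀ - u₀) + (v₁ - u₁) * ((X₀ + X₁) / 2)) / p ≤ p - 1 := by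
      rw [div_le_iff₀ hp0]
      calc _ ≤ ((p : ℝ) - 1) * (p - 1) :=
            mul_le_mul (by linarith) ha1 ha0 (by linarith)
        _ ≤ _ := by nlinarith
    calc _ ≤ (p : ℝ) - 1 := by rw [abs_le]; constructor <;> linarith
      _ < P ^ 4 := by rw [hPp]; linarith
      _ = P ^ 3 * P := by ring
      _ ≤ P ^ 3 * (3 * L) := by gcongr
      _ = _ := by ring
  · have hP12 : 12 ≤ P :=
      exp_five_halves_mem_Icc.1.trans (Real.exp_le_exp.2 (by linarith))
    have hIcc : ∀ x ∈ Finset.Ico (max 1 ⌈X₀⌉₊) (⌊X₁⌋₊ + 1), (x : ℝ) ∈ Set.Icc X₀ X₁ := by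
      intro x hx
      rw [Finset.mem_Ico, max_le_iff, Nat.ceil_le, Nat.lt_succ_iff, Nat.le_floor_iff hX₁0] at hx
      exact ⟨hx.1.2, hx.2⟩
    have hN : 1 ≤ p.sqrt := Nat.sqrt_pos.2 hp.pos
    have hmain := abs_card_invMod_sub_sum_le hP hPp hN u₀ u₁ v₀ v₁ (le_max_left 1 ⌈X₀⌉₊) hnp
      (fun x hx => hu _ (hIcc x hx)) (fun x hx => huv _ (hIcc x hx))
      (fun x hx => by linarith [hv _ (hIcc x hx)])
    have harea := abs_integral_affine_sub_sum_le hX₀ hX hf hfB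
    have harea' : |(∑ x ∈ Finset.Ico (max 1 ⌈X₀⌉₊) (⌊X₁⌋₊ + 1),
        ((v₀ - u₀) + (v₁ - u₁) * (x : ℝ))) / p -
        (X₁ - X₀) * ((v₀ - u₀) + (v₁ - u₁) * ((X₀ + X₁) / 2)) / p| ≤ 2 := by
      rw [← sub_div, abs_div, abs_of_pos hp0, div_le_iff₀ hp0]
      linarith
    have hNr : (1 : ℝ) ≤ p.sqrt := by exact_mod_cast hN
    have hNsq : (p.sqrt : ℝ) ^ 2 ≤ p := by exact_mod_cast Nat.sqrt_le' p
    have hNlt : (p : ℝ) < ((p.sqrt : ℝ) + 1) ^ 2 := by exact_mod_cast Nat.lt_succ_sqrt' p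
    have hNP : (p.sqrt : ℝ) ≤ P ^ 2 := by
      refine le_of_pow_le_pow_left₀ two_ne_zero (by positivity) ?_
      rw [← pow_mul, hPp]
      exact hNsq
    have hlog : Real.log p.sqrt ≤ L / 2 := by
      have h := Real.log_le_log (by positivity) hNsq
      rw [Real.log_pow] at h
      push_cast at h
      linarith
    have hpN : (p : ℝ) / (2 * p.sqrt) ≤ 2 * P ^ 2 := by
      rw [div_le_iff₀ (by positivity)]
      nlinarith
    have hP23 : 12 * P ^ 2 ≤ P ^ 3 := by nlinarith [sq_nonneg P]
    have hbound : sawtoothBound p p.sqrt P ≤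
        2 * P ^ 2 + 6.3 * P ^ 3 * (1 + L / 2) / 3 + 2 * (6.3 * P ^ 3) / 9 + 2 * P ^ 2 / 9 := by
      unfold sawtoothBound
      gcongr
    have hP2 : 144 ≤ P ^ 2 := by nlinarith
    have hfin : 2 * (2 * P ^ 2 + 6.3 * P ^ 3 * (1 + L / 2) / 3 + 2 * (6.3 * P ^ 3) / 9 +
        2 * P ^ 2 / 9) + 2 < 3 * P ^ 3 * L := by
      have h : P ^ 3 * 10 ≤ P ^ 3 * L := by gcongr
      nlinarith
    calc _ ≤ _ := abs_sub_le _ _ _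
      _ ≤ 2 * sawtoothBound p p.sqrt P + 2 := add_le_add hmain harea'
      _ < _ := by linarith

lemma mem_convexHull_triple_iff {E : Type*} [AddCommGroup E] [Module ℝ E] {A B C z : E} :
    z ∈ convexHull ℝ ({A, B, C} : Set E) ↔
      ∃ s t : ℝ, 0 ≤ s ∧ 0 ≤ t ∧ s + t ≤ 1 ∧ z = (1 - s - t) • A + s • B + t • C := by
  constructor
  · intro hz
    rw [convexHull_insert (by simp), convexHull_pair, mem_convexJoin] at hz
    obtain ⟨a, ha, w, ⟨γ, δ, hγ, hδ, hγδ, rfl⟩, α, β, hα, hβ, hαβ, rfl⟩ := hz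
    rw [Set.mem_singleton_iff] at ha
    subst ha
    refine ⟨β * γ, β * δ, by positivity, by positivity, ?_, ?_⟩
    · rw [← mul_add, hγδ]; linarith
    · have : 1 - β * γ - β * δ = α := by linear_combination -β * hγδ - hαβ
      rw [this, smul_add, smul_smul, smul_smul, add_assoc]
  · rintro ⟨s, t, hs, ht, hst, rfl⟩
    have h := (convex_convexHull ℝ ({A, B, C} : Set E)).sum_mem (t := Finset.univ)
      (w := ![1 - s - t, s, t]) (z := ![A, B, C]) ?_ ?_ ?_
    · simpa [Fin.sum_univ_three] using h
    · intro i _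
      fin_cases i <;> simp <;> linarith
    · simp only [Fin.sum_univ_three, Matrix.cons_val]
      ring
    · intro i _
      fin_cases i <;> exact subset_convexHull ℝ _ (by simp)

/-- A right triangle with legs parallel to the axes, as a region between a leg and the
hypotenuse. -/
lemma mem_convexHull_right_triangle_iff {A B C : ℝ × ℝ} (hAB : B.2 = A.2) (hAC : C.1 = A.1)
    (z : ℝ × ℝ) :
    z ∈ convexHull ℝ ({A, B, C} : Set (ℝ × ℝ)) ↔ z.1 ∈ Set.uIcc A.1 B.1 ∧
      z.2 ∈ Set.uIcc A.2 (C.2 - (C.2 - A.2) / (B.1 - A.1) * (z.1 - A.1)) := by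
  obtain ⟨a₁, a₂⟩ := A
  obtain ⟨b₁, b₂⟩ := B
  obtain ⟨c₁, c₂⟩ := C
  obtain ⟨x, y⟩ := z
  simp only at hAB hAC
  subst hAB hAC
  rw [mem_convexHull_triple_iff, ← segment_eq_uIcc, ← segment_eq_uIcc, segment_eq_image',
    segment_eq_image']
  simp only [Set.mem_image, Set.mem_Icc, smul_eq_mul, Prod.smul_mk, Prod.mk_add_mk,
    Prod.mk.injEq]
  constructor
  · rintro ⟨s, t, hs, ht, hst, hx, hy⟩
    refine ⟨⟨s, ⟨hs, by linarith⟩, by rw [hx]; ring⟩, ?_⟩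
    have hx' : x - c₁ = s * (b₁ - c₁) := by rw [hx]; ring
    have hy' : y = b₂ + t * (c₂ - b₂) := by rw [hy]; ring
    obtain ⟨r, hr, hr'⟩ : ∃ r, t ≤ r ∧
        c₂ - (c₂ - b₂) / (b₁ - c₁) * (x - c₁) = b₂ + r * (c₂ - b₂) := by
      rcases eq_or_ne (b₁ - c₁) 0 with h | h
      · exact ⟨1, by linarith, by rw [h]; simp⟩
      · refine ⟨1 - s, by linarith, ?_⟩
        rw [hx']
        field_simp
        ring
    rcases (ht.trans hr).eq_or_lt with h0 | h0
    · have : t = 0 := by linarith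
      exact ⟨0, by norm_num, by rw [hy', this]; ring⟩
    · refine ⟨t / r, ⟨by positivity, (div_le_one h0).2 hr⟩, ?_⟩
      rw [hr', hy']
      field_simp
      ring
  · rintro ⟨⟨s, ⟨hs0, hs1⟩, hx⟩, θ, ⟨hθ0, hθ1⟩, hy⟩
    rcases eq_or_ne (b₁ - c₁) 0 with h | h
    · rw [h] at hy hx
      refine ⟨0, θ, le_rfl, hθ0, by linarith, by rw [← hx]; ring, ?_⟩
      rw [← hy]
      simp
      ring
    · refine ⟨s, θ * (1 - s), hs0, mul_nonneg hθ0 (by linarith), by nlinarith, ?_, ?_⟩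
      · rw [← hx]; ring
      · rw [← hy, ← hx]
        field_simp
        ring

/-- For a right triangle `T ⊆ [0,p-1]²` with the two legs parallel to the coordinate
axes (right angle at vertex `A`, so `B` has the same second coordinate as `A` and `C`
the same first coordinate), the points `(x, x̄)` are equidistributed in `T`. -/
theorem stmt_14 (p : ℕ) (hp : p.Prime) (A B C : ℝ × ℝ)
    (hAB : B.2 = A.2) (hAC : C.1 = A.1)
    (hsub : convexHull ℝ ({A, B, C} : Set (ℝ × ℝ)) ⊆
      Set.Icc ((0 : ℝ), (0 : ℝ)) (((p : ℝ) - 1), ((p : ℝ) - 1))) :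
    |(invCount p (convexHull ℝ ({A, B, C} : Set (ℝ × ℝ))) : ℝ) -
        (volume (convexHull ℝ ({A, B, C} : Set (ℝ × ℝ)))).toReal / p|
      < 3 * (p : ℝ) ^ ((3 : ℝ) / 4) * Real.log p := by
  have hA := hsub (subset_convexHull ℝ _ (by simp : A ∈ ({A, B, C} : Set (ℝ × ℝ))))
  have hB := hsub (subset_convexHull ℝ _ (by simp : B ∈ ({A, B, C} : Set (ℝ × ℝ))))
  have hC := hsub (subset_convexHull ℝ _ (by simp : C ∈ ({A, B, C} : Set (ℝ × ℝ))))
  simp only [Set.mem_Icc, Prod.le_def] at hA hB hC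
  have hmem := mem_convexHull_right_triangle_iff hAB hAC
  set σ := (C.2 - A.2) / (B.1 - A.1) with hσ
  have hyp : ∀ x ∈ Set.uIcc A.1 B.1, ∃ r, 0 ≤ r ∧ r ≤ 1 ∧
      C.2 - σ * (x - A.1) = A.2 + r * (C.2 - A.2) := by
    intro x hx
    rw [← segment_eq_uIcc, segment_eq_image'] at hx
    obtain ⟨s, ⟨hs0, hs1⟩, rfl⟩ := hx
    rcases eq_or_ne (B.1 - A.1) 0 with h | h
    · exact ⟨1, by norm_num, le_rfl, by rw [hσ, h]; simp⟩
    · refine ⟨1 - s, by linarith, by linarith, ?_⟩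
      simp only [hσ, smul_eq_mul]
      field_simp
      ring
  have hX₀ : 0 ≤ min A.1 B.1 := le_min hA.1.1 hB.1.1
  have hX₁ : max A.1 B.1 ≤ p - 1 := max_le hA.2.1 hB.2.1
  rcases le_total A.2 C.2 with h | h
  · have hle : ∀ x ∈ Set.uIcc A.1 B.1, A.2 ≤ C.2 - σ * (x - A.1) := by
      intro x hx
      obtain ⟨r, hr0, hr1, hr⟩ := hyp x hx
      rw [hr]
      nlinarith
    have hT : convexHull ℝ ({A, B, C} : Set (ℝ × ℝ)) =
        affineRegion (min A.1 B.1) (max A.1 B.1) A.2 0 (C.2 + σ * A.1) (-σ) := by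
      ext z
      rw [hmem]
      refine and_congr_right fun hz => ?_
      rw [Set.uIcc_of_le (hle _ hz)]
      ring_nf
    rw [hT]
    refine abs_invCount_affineRegion_sub_lt hp hX₀ min_le_max hX₁ ?_ ?_ ?_
    · intro x _
      linarith [hA.1.2]
    · intro x hx
      linarith [hle x hx]
    · intro x hx
      obtain ⟨r, hr0, hr1, hr⟩ := hyp x hx
      nlinarith [hC.2.2]
  · have hle : ∀ x ∈ Set.uIcc A.1 B.1, C.2 - σ * (x - A.1) ≤ A.2 := by
      intro x hx
      obtain ⟨r, hr0, hr1, hr⟩ := hyp x hx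
      rw [hr]
      nlinarith
    have hT : convexHull ℝ ({A, B, C} : Set (ℝ × ℝ)) =
        affineRegion (min A.1 B.1) (max A.1 B.1) (C.2 + σ * A.1) (-σ) A.2 0 := by
      ext z
      rw [hmem]
      refine and_congr_right fun hz => ?_
      rw [Set.uIcc_of_ge (hle _ hz)]
      ring_nf
    rw [hT]
    refine abs_invCount_affineRegion_sub_lt hp hX₀ min_le_max hX₁ ?_ ?_ ?_
    · intro x hx
      obtain ⟨r, hr0, hr1, hr⟩ := hyp x hx
      nlinarith [hC.1.2]
    · intro x hx
      linarith [hle x hx]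
    · intro x _
      linarith [hA.2.2]
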